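/- Lower bounds for the Cesàro and Abel limits: for every y0 ∈ Y, liminf_{T→∞} v_T(y0) ≥ d̂*(y0) and liminf_{ε→0} h_ε(y0) ≥ d̂*(y0). -/

import Mathlib

open MeasureTheory Filter Set Topology
open scoped ENNReal NNReal

noncomputable section

namespace StochLP

/-- The model of the controlled stochastic discrete time system (controlled stochastic
recursion) `y(t+1) = f(y(t), u(t), s(t))` from the paper: `Y ⊂ ℝⁿ` is a compact forward
invariant state constraint set, `Uc` is a compact metric control space, `S` is a Polish
noise space, `U` is an upper semicontinuous compact valued control constraint
multifunction (upper semicontinuity of a compact valued map into a compact space being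
recorded as closedness of its graph), `f` is bounded, continuous in `(y,u)` and Borel
measurable in `s`, and `ν` is the common law of the i.i.d. noise elements `s(t)`. -/
structure Model (n : ℕ) (Uc S : Type) [MetricSpace Uc] [CompactSpace Uc]
    [MeasurableSpace Uc] [BorelSpace Uc] [TopologicalSpace S] [PolishSpace S]
    [MeasurableSpace S] [BorelSpace S] where
  Y : Set (Fin n → ℝ)
  U : (Fin n → ℝ) → Set Uc
  f : (Fin n → ℝ) → Uc → S → (Fin n → ℝ)
  ν : Measure S
  ν_prob : IsProbabilityMeasure ν
  Y_compact : IsCompact Y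
  Y_nonempty : Y.Nonempty
  U_nonempty : ∀ y ∈ Y, (U y).Nonempty
  U_compact : ∀ y ∈ Y, IsCompact (U y)
  graph_closed : IsClosed {p : (Fin n → ℝ) × Uc | p.1 ∈ Y ∧ p.2 ∈ U p.1}
  f_bounded : ∃ C : ℝ, ∀ y ∈ Y, ∀ (u : Uc) (s : S), ‖f y u s‖ ≤ C
  f_cont : ∀ s : S, ContinuousOn (fun p : (Fin n → ℝ) × Uc => f p.1 p.2 s) (Y ×ˢ univ)
  f_meas : ∀ y ∈ Y, ∀ u : Uc, Measurable fun s => f y u s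
  f_inv : ∀ y ∈ Y, ∀ u ∈ U y, ∀ s : S, f y u s ∈ Y

variable {n : ℕ} {Uc S : Type} [MetricSpace Uc] [CompactSpace Uc] [MeasurableSpace Uc]
  [BorelSpace Uc] [TopologicalSpace S] [PolishSpace S] [MeasurableSpace S] [BorelSpace S]

/-- A control plan: a sequence of Borel measurable selections of the multifunction `U`. -/
structure Plan (M : Model n Uc S) where
  π : ℕ → (Fin n → ℝ) → Uc
  measurable : ∀ t, Measurable (π t)
  feasible : ∀ t, ∀ y ∈ M.Y, π t y ∈ M.U y

/-- The law of the state `y^{π,y₀}(t)` of the controlled stochastic recursion started at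
`y₀` and driven by the i.i.d. noise with common law `ν`, defined by the Markov recursion.  -/
def stateLaw (M : Model n Uc S) (t : ℕ) :
    (ℕ → (Fin n → ℝ) → Uc) → (Fin n → ℝ) → Measure (Fin n → ℝ) :=
  Nat.rec (motive := fun _ => (ℕ → (Fin n → ℝ) → Uc) → (Fin n → ℝ) → Measure (Fin n → ℝ))
    (fun _ y => Measure.dirac y)
    (fun _ ih π y =>
      (M.ν.map fun s => M.f y (π 0 y) s).bind fun y' => ih (fun j => π (j + 1)) y') t

/-- The joint law of the state-control pair `(y^{π,y₀}(t), u^{π,y₀}(t))`. -/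
def saLaw (M : Model n Uc S) (t : ℕ) (π : ℕ → (Fin n → ℝ) → Uc) (y0 : Fin n → ℝ) :
    Measure ((Fin n → ℝ) × Uc) :=
  (stateLaw M t π y0).map fun z => (z, π t z)

/-- `E[q(y^{π,y₀}(t), u^{π,y₀}(t))]`. -/
def expSA (M : Model n Uc S) (t : ℕ) (π : ℕ → (Fin n → ℝ) → Uc) (y0 : Fin n → ℝ)
    (q : (Fin n → ℝ) → Uc → ℝ) : ℝ :=
  ∫ p, q p.1 p.2 ∂saLaw M t π y0

/-- The finite horizon average expected cost `(1/T) E[Σ_{t=0}^{T-1} k(y(t),u(t))]`. -/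
def costT (M : Model n Uc S) (k : (Fin n → ℝ) → Uc → ℝ) (T : ℕ) (π : ℕ → (Fin n → ℝ) → Uc)
    (y0 : Fin n → ℝ) : ℝ :=
  (1 / (T : ℝ)) * ∑ t ∈ Finset.range T, expSA M t π y0 k

/-- The optimal value `v_T(y₀)` of the finite horizon problem. -/
def vT (M : Model n Uc S) (k : (Fin n → ℝ) → Uc → ℝ) (T : ℕ) (y0 : Fin n → ℝ) : ℝ :=
  ⨅ π : Plan M, costT M k T π.π y0

/-- The expected discounted cost `ε Σ_{t=0}^∞ (1-ε)^t E[k(y(t),u(t))]`. -/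
def costDisc (M : Model n Uc S) (k : (Fin n → ℝ) → Uc → ℝ) (ε : ℝ)
    (π : ℕ → (Fin n → ℝ) → Uc) (y0 : Fin n → ℝ) : ℝ :=
  ε * ∑' t : ℕ, (1 - ε) ^ t * expSA M t π y0 k

/-- The optimal value `h_ε(y₀)` of the discounted problem. -/
def hEps (M : Model n Uc S) (k : (Fin n → ℝ) → Uc → ℝ) (ε : ℝ) (y0 : Fin n → ℝ) : ℝ :=
  ⨅ π : Plan M, costDisc M k ε π.π y0

/-- The graph `G` of the multifunction `U`. -/
def graphG (M : Model n Uc S) : Set ((Fin n → ℝ) × Uc) := {p | p.1 ∈ M.Y ∧ p.2 ∈ M.U p.1}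

/-- `E[φ(f(y,u,s))]`, the expectation over the noise of `φ` evaluated after one step. -/
def Ef (M : Model n Uc S) (φ : (Fin n → ℝ) → ℝ) (y : Fin n → ℝ) (u : Uc) : ℝ :=
  ∫ s, φ (M.f y u s) ∂M.ν

/-- A measure on `Y × Uc` is concentrated on the graph `G` (this encodes measures defined
on Borel subsets of `G`). -/
def onG (M : Model n Uc S) (γ : Measure ((Fin n → ℝ) × Uc)) : Prop := γ (graphG M)ᶜ = 0

/-- The set `W` of stationary measures. -/
def Wset (M : Model n Uc S) : Set (Measure ((Fin n → ℝ) × Uc)) :=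
  {γ | IsProbabilityMeasure γ ∧ onG M γ ∧
    ∀ φ : (Fin n → ℝ) → ℝ, Continuous φ → ∫ p, (Ef M φ p.1 p.2 - φ p.1) ∂γ = 0}

/-- The set `W(ε, y₀)` of discounted stationary measures. -/
def Weps (M : Model n Uc S) (ε : ℝ) (y0 : Fin n → ℝ) : Set (Measure ((Fin n → ℝ) × Uc)) :=
  {γ | IsProbabilityMeasure γ ∧ onG M γ ∧
    ∀ φ : (Fin n → ℝ) → ℝ, Continuous φ →
      ∫ p, ((1 - ε) * (Ef M φ p.1 p.2 - φ p.1) + ε * (φ y0 - φ p.1)) ∂γ = 0}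

/-- The optimal value `k*(ε, y₀)` of the IDLP problem over `W(ε, y₀)`. -/
def kStarEps (M : Model n Uc S) (k : (Fin n → ℝ) → Uc → ℝ) (ε : ℝ) (y0 : Fin n → ℝ) : ℝ :=
  sInf ((fun γ : Measure ((Fin n → ℝ) × Uc) => ∫ p, k p.1 p.2 ∂γ) '' Weps M ε y0)

/-- The optimal value `k*` of the IDLP problem over `W`. -/
def kStar (M : Model n Uc S) (k : (Fin n → ℝ) → Uc → ℝ) : ℝ :=
  sInf ((fun γ : Measure ((Fin n → ℝ) × Uc) => ∫ p, k p.1 p.2 ∂γ) '' Wset M)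

/-- The optimal value `μ*(ε, y₀)` of the problem dual to the IDLP problem over `W(ε,y₀)`. -/
def muStarEps (M : Model n Uc S) (k : (Fin n → ℝ) → Uc → ℝ) (ε : ℝ) (y0 : Fin n → ℝ) : ℝ :=
  sSup {r : ℝ | ∃ ψ : (Fin n → ℝ) → ℝ, Continuous ψ ∧
    r = sInf ((fun p : (Fin n → ℝ) × Uc =>
      k p.1 p.2 + (1 - ε) * (Ef M ψ p.1 p.2 - ψ p.1) + ε * (ψ y0 - ψ p.1)) '' graphG M)}

/-- The optimal value `μ*` of the problem dual to the IDLP problem over `W`. -/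
def muStar (M : Model n Uc S) (k : (Fin n → ℝ) → Uc → ℝ) : ℝ :=
  sSup {r : ℝ | ∃ ψ : (Fin n → ℝ) → ℝ, Continuous ψ ∧
    r = sInf ((fun p : (Fin n → ℝ) × Uc => k p.1 p.2 + Ef M ψ p.1 p.2 - ψ p.1) '' graphG M)}

/-- The feasible set `Ω(y₀)` of the augmented IDLP problem. -/
def OmegaSet (M : Model n Uc S) (y0 : Fin n → ℝ) :
    Set (Measure ((Fin n → ℝ) × Uc) × Measure ((Fin n → ℝ) × Uc)) :=
  {p | p.1 ∈ Wset M ∧ IsFiniteMeasure p.2 ∧ onG M p.2 ∧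
    ∀ φ : (Fin n → ℝ) → ℝ, Continuous φ →
      ∫ q, (φ y0 - φ q.1) ∂p.1 + ∫ q, (Ef M φ q.1 q.2 - φ q.1) ∂p.2 = 0}

/-- The optimal value `k*(y₀)` of the augmented IDLP problem. -/
def kStarAug (M : Model n Uc S) (k : (Fin n → ℝ) → Uc → ℝ) (y0 : Fin n → ℝ) : ℝ :=
  sInf ((fun p : Measure ((Fin n → ℝ) × Uc) × Measure ((Fin n → ℝ) × Uc) =>
    ∫ q, k q.1 q.2 ∂p.1) '' OmegaSet M y0)

/-- Feasibility of `(μ, ψ, η)` for the problem dual to the augmented IDLP problem. -/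
def DualFeas (M : Model n Uc S) (k : (Fin n → ℝ) → Uc → ℝ) (y0 : Fin n → ℝ)
    (ψ η : (Fin n → ℝ) → ℝ) (μ : ℝ) : Prop :=
  (∀ p ∈ graphG M, 0 ≤ k p.1 p.2 + (ψ y0 - ψ p.1) + Ef M η p.1 p.2 - η p.1 - μ) ∧
  (∀ p ∈ graphG M, 0 ≤ Ef M ψ p.1 p.2 - ψ p.1)

/-- The optimal value `d*(y₀)` of the dual (with continuous test functions) of the
augmented IDLP problem. -/
def dStar (M : Model n Uc S) (k : (Fin n → ℝ) → Uc → ℝ) (y0 : Fin n → ℝ) : ℝ :=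
  sSup {μ : ℝ | ∃ ψ η : (Fin n → ℝ) → ℝ, Continuous ψ ∧ Continuous η ∧
    DualFeas M k y0 ψ η μ}

/-- Bounded Borel measurable real valued functions. -/
def BddBorel (ψ : (Fin n → ℝ) → ℝ) : Prop := Measurable ψ ∧ ∃ C : ℝ, ∀ y, |ψ y| ≤ C

/-- The optimal value `d̂*(y₀)` of the relaxed dual (with bounded Borel test functions) of
the augmented IDLP problem. -/
def dHatStar (M : Model n Uc S) (k : (Fin n → ℝ) → Uc → ℝ) (y0 : Fin n → ℝ) : ℝ :=
  sSup {μ : ℝ | ∃ ψ η : (Fin n → ℝ) → ℝ, BddBorel ψ ∧ BddBorel η ∧ DualFeas M k y0 ψ η μ}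

/-- The occupational measure `γ^{π,y₀,T}`. -/
def occT (M : Model n Uc S) (T : ℕ) (π : ℕ → (Fin n → ℝ) → Uc) (y0 : Fin n → ℝ) :
    Measure ((Fin n → ℝ) × Uc) :=
  (T : ℝ≥0∞)⁻¹ • ∑ t ∈ Finset.range T, saLaw M t π y0

/-- The discounted occupational measure `γ_d^{π,y₀,ε}`. -/
def discOcc (M : Model n Uc S) (ε : ℝ) (π : ℕ → (Fin n → ℝ) → Uc) (y0 : Fin n → ℝ) :
    Measure ((Fin n → ℝ) × Uc) :=
  ENNReal.ofReal ε • Measure.sum fun t : ℕ => ENNReal.ofReal (1 - ε) ^ t • saLaw M t π y0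

/-- The set `Θ_ε(y₀)` of discounted occupational measures, as a set of probability
measures (carrying the topology of weak convergence). -/
def ThetaEps (M : Model n Uc S) (ε : ℝ) (y0 : Fin n → ℝ) :
    Set (ProbabilityMeasure ((Fin n → ℝ) × Uc)) :=
  {μ | ∃ π : Plan M, μ.toMeasure = discOcc M ε π.π y0}

/-- `Θ_ε := ∪_{y₀ ∈ Y} Θ_ε(y₀)`. -/
def ThetaEpsAll (M : Model n Uc S) (ε : ℝ) : Set (ProbabilityMeasure ((Fin n → ℝ) × Uc)) :=
  ⋃ y0 ∈ M.Y, ThetaEps M ε y0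

/-- The set `Γ_T(y₀)` of occupational measures. -/
def GammaT (M : Model n Uc S) (T : ℕ) (y0 : Fin n → ℝ) :
    Set (ProbabilityMeasure ((Fin n → ℝ) × Uc)) :=
  {μ | ∃ π : Plan M, μ.toMeasure = occT M T π.π y0}

/-- `Γ_T := ∪_{y₀ ∈ Y} Γ_T(y₀)`. -/
def GammaTAll (M : Model n Uc S) (T : ℕ) : Set (ProbabilityMeasure ((Fin n → ℝ) × Uc)) :=
  ⋃ y0 ∈ M.Y, GammaT M T y0

/-- `W` as a set of probability measures. -/
def WsetPM (M : Model n Uc S) : Set (ProbabilityMeasure ((Fin n → ℝ) × Uc)) :=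
  {μ | μ.toMeasure ∈ Wset M}

/-- `W(ε,y₀)` as a set of probability measures. -/
def WepsPM (M : Model n Uc S) (ε : ℝ) (y0 : Fin n → ℝ) :
    Set (ProbabilityMeasure ((Fin n → ℝ) × Uc)) :=
  {μ | μ.toMeasure ∈ Weps M ε y0}

/-- The set of finite convex combinations of elements of a set of probability measures,
i.e. its convex hull. -/
def convexCombos {α : Type*} [MeasurableSpace α] (A : Set (ProbabilityMeasure α)) :
    Set (ProbabilityMeasure α) :=
  {μ | ∃ (m : ℕ) (w : Fin m → ℝ≥0) (γ : Fin m → ProbabilityMeasure α),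
    (∀ i, γ i ∈ A) ∧ (∑ i, w i) = 1 ∧
    μ.toMeasure = ∑ i, (w i : ℝ≥0∞) • (γ i).toMeasure}

/-- Membership in the set `D₁(y₀)`. -/
def D1mem (M : Model n Uc S) (y0 : Fin n → ℝ) (γ : Measure ((Fin n → ℝ) × Uc)) : Prop :=
  ∃ ξ : ℕ → Measure ((Fin n → ℝ) × Uc),
    (∀ l, IsFiniteMeasure (ξ l) ∧ onG M (ξ l)) ∧
    ∀ φ : (Fin n → ℝ) → ℝ, Continuous φ →
      Tendsto (fun l => ∫ q, (Ef M φ q.1 q.2 - φ q.1) ∂ξ l) atTop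
        (𝓝 (∫ q, (φ q.1 - φ y0) ∂γ))

/-- A control plan is periodic regime generating (PRG) for the initial point `y₀`. -/
def IsPRG (M : Model n Uc S) (π : Plan M) (y0 : Fin n → ℝ) : Prop :=
  ∃ T0 Tp : ℕ, 0 < Tp ∧
    ∀ q : ((Fin n → ℝ) × Uc) → ℝ, Continuous q →
      ∀ t, T0 ≤ t → ∫ p, q p ∂saLaw M t π.π y0 = ∫ p, q p ∂saLaw M (t + Tp) π.π y0

/-- The optimal value `V_per(y₀)` over periodic regime generating control plans. -/
def Vper (M : Model n Uc S) (k : (Fin n → ℝ) → Uc → ℝ) (y0 : Fin n → ℝ) : ℝ :=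
  sInf {c : ℝ | ∃ π : Plan M, IsPRG M π y0 ∧
    Tendsto (fun T => costT M k T π.π y0) atTop (𝓝 c)}

/-- The optimal value `k*_θ(y₀)` of the perturbed augmented IDLP problem. -/
def kStarTheta (M : Model n Uc S) (k θ : (Fin n → ℝ) → Uc → ℝ) (y0 : Fin n → ℝ) : ℝ :=
  sInf ((fun p : Measure ((Fin n → ℝ) × Uc) × Measure ((Fin n → ℝ) × Uc) =>
    ∫ q, k q.1 q.2 ∂p.1 + ∫ q, θ q.1 q.2 ∂p.2) '' OmegaSet M y0)

/-- Feasibility of `(μ, ψ, η)` for the perturbed dual problem. -/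
def DualFeasTheta (M : Model n Uc S) (k θ : (Fin n → ℝ) → Uc → ℝ) (y0 : Fin n → ℝ)
    (ψ η : (Fin n → ℝ) → ℝ) (μ : ℝ) : Prop :=
  (∀ p ∈ graphG M, 0 ≤ k p.1 p.2 + (ψ y0 - ψ p.1) + Ef M η p.1 p.2 - η p.1 - μ) ∧
  (∀ p ∈ graphG M, -θ p.1 p.2 ≤ Ef M ψ p.1 p.2 - ψ p.1)

/-- The optimal value `d*_θ(y₀)` of the perturbed dual problem. -/
def dStarTheta (M : Model n Uc S) (k θ : (Fin n → ℝ) → Uc → ℝ) (y0 : Fin n → ℝ) : ℝ :=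
  sSup {μ : ℝ | ∃ ψ η : (Fin n → ℝ) → ℝ, Continuous ψ ∧ Continuous η ∧
    DualFeasTheta M k θ y0 ψ η μ}

/-- The optimal value `d̄*_θ(y₀)` of the second form of the perturbed dual problem. -/
def dBarTheta (M : Model n Uc S) (k θ : (Fin n → ℝ) → Uc → ℝ) (y0 : Fin n → ℝ) : ℝ :=
  sSup {r : ℝ | ∃ ψ η : (Fin n → ℝ) → ℝ, Continuous ψ ∧ Continuous η ∧ r = ψ y0 ∧
    (∀ p ∈ graphG M, 0 ≤ k p.1 p.2 - ψ p.1 + Ef M η p.1 p.2 - η p.1) ∧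
    (∀ p ∈ graphG M, -θ p.1 p.2 ≤ Ef M ψ p.1 p.2 - ψ p.1)}

/-- One step of the selection procedure: shrink `A` to `A ∩ B` if this keeps it nonempty. -/
def shrink {α : Type*} (A B : Set α) : Set α :=
  {a ∈ A | (A ∩ B).Nonempty → a ∈ B}

lemma shrink_nonempty {α : Type*} {A : Set α} (B : Set α) (hA : A.Nonempty) :
    (shrink A B).Nonempty := by
  by_cases h : (A ∩ B).Nonempty
  · obtain ⟨a, ha⟩ := h
    exact ⟨a, ha.1, fun _ => ha.2⟩
  · obtain ⟨a, ha⟩ := hA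
    exact ⟨a, ha, fun h' => absurd h' h⟩

lemma shrink_inter_nonempty_iff {α : Type*} (A B D : Set α) :
    (shrink A B ∩ D).Nonempty ↔
      (A ∩ (B ∩ D)).Nonempty ∨ (¬ (A ∩ B).Nonempty ∧ (A ∩ D).Nonempty) := by
  constructor
  · rintro ⟨a, ⟨haA, haB⟩, haD⟩
    by_cases h : (A ∩ B).Nonempty
    · exact Or.inl ⟨a, haA, haB h, haD⟩
    · exact Or.inr ⟨h, a, haA, haD⟩
  · rintro (⟨a, haA, haB, haD⟩ | ⟨h, a, haA, haD⟩)
    · exact ⟨a, ⟨haA, fun _ => haB⟩, haD⟩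
    · exact ⟨a, ⟨haA, fun h' => absurd h' h⟩, haD⟩

lemma isClosed_shrink {α : Type*} [TopologicalSpace α] {A B : Set α} (hA : IsClosed A)
    (hB : IsClosed B) : IsClosed (shrink A B) := by
  by_cases h : (A ∩ B).Nonempty
  · have : shrink A B = A ∩ B := by ext a; simp [shrink, h]
    rw [this]
    exact hA.inter hB
  · have : shrink A B = A := by ext a; simp [shrink, h]
    rwa [this]

/-- Measurable selection for closed valued multifunctions into a compact space. -/
theorem exists_measurable_selection {X α : Type*} [MeasurableSpace X] [TopologicalSpace α]
    [CompactSpace α] [T1Space α] [SecondCountableTopology α] [MeasurableSpace α] [BorelSpace α]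
    (F : X → Set α) (hne : ∀ x, (F x).Nonempty) (hcl : ∀ x, IsClosed (F x))
    (hmeas : ∀ D : Set α, IsClosed D → MeasurableSet {x | (F x ∩ D).Nonempty}) :
    ∃ g : X → α, Measurable g ∧ ∀ x, g x ∈ F x := by
  obtain ⟨b, hbc, -, hb⟩ := TopologicalSpace.exists_countable_basis α
  obtain ⟨e, he⟩ := (hbc.insert ∅).exists_eq_range (insert_nonempty _ _)
  have heo : ∀ i, IsOpen (e i) := fun i => by
    have : e i ∈ insert ∅ b := he ▸ mem_range_self i
    rcases this with h | h
    · rw [h]; exact isOpen_empty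
    · exact hb.isOpen h
  let V : ℕ → X → Set α := fun i => Nat.rec F (fun i V x => shrink (V x) (e i)ᶜ) i
  have hVs : ∀ i x, V (i + 1) x = shrink (V i x) (e i)ᶜ := fun _ _ => rfl
  have hVne : ∀ i x, (V i x).Nonempty := fun i x => by
    induction i with
    | zero => exact hne x
    | succ i ih => exact shrink_nonempty _ ih
  have hVcl : ∀ i x, IsClosed (V i x) := fun i x => by
    induction i with
    | zero => exact hcl x
    | succ i ih => exact isClosed_shrink ih (heo i).isClosed_compl
  have hVm : ∀ i, ∀ D : Set α, IsClosed D → MeasurableSet {x | (V i x ∩ D).Nonempty} := by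
    intro i
    induction i with
    | zero => exact hmeas
    | succ i ih =>
      intro D hD
      simp only [hVs, shrink_inter_nonempty_iff]
      have hc := (heo i).isClosed_compl
      exact (ih _ (hc.inter hD)).union ((ih _ hc).compl.inter (ih _ hD))
  have hVanti : ∀ i x, V (i + 1) x ⊆ V i x := fun i x a ha => ha.1
  have hint : ∀ x, (⋂ i, V i x).Nonempty := fun x =>
    IsCompact.nonempty_iInter_of_sequence_nonempty_isCompact_isClosed _ (hVanti · x) (hVne · x)
      (hVcl 0 x).isCompact (hVcl · x)
  choose g hg using hint
  have hg' : ∀ i x, g x ∈ V i x := fun i x => mem_iInter.1 (hg x) i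
  have huniq : ∀ x a, (∀ i, a ∈ V i x) → a = g x := by
    intro x a ha
    by_contra hne
    obtain ⟨s, hs, hgs, hsub⟩ := hb.exists_subset_of_mem_open
      (show g x ∈ ({a}ᶜ : Set α) from fun h => hne h.symm) isOpen_compl_singleton
    obtain ⟨i, rfl⟩ : s ∈ range e := he ▸ mem_insert_of_mem _ hs
    exact (hg' (i + 1) x).2 ⟨a, ha i, fun h => hsub h rfl⟩ hgs
  refine ⟨g, measurable_of_isClosed fun D hD => ?_, fun x => hg' 0 x⟩
  have : g ⁻¹' D = ⋂ i, {x | (V i x ∩ D).Nonempty} := by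
    ext x
    simp only [mem_preimage, mem_iInter, mem_ofPred_eq]
    refine ⟨fun h i => ⟨g x, hg' i x, h⟩, fun h => ?_⟩
    obtain ⟨a, ha⟩ := IsCompact.nonempty_iInter_of_sequence_nonempty_isCompact_isClosed
      (fun i => V i x ∩ D) (fun i => inter_subset_inter_left _ (hVanti i x)) h
      ((hVcl 0 x).inter hD).isCompact (fun i => (hVcl i x).inter hD)
    have ha' := fun i => mem_iInter.1 ha i
    rw [← huniq x a fun i => (ha' i).1]
    exact (ha' 0).2
  rw [this]
  exact MeasurableSet.iInter fun i => hVm i D hD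

lemma Model.measurableSet_Y (M : Model n Uc S) : MeasurableSet M.Y :=
  M.Y_compact.isClosed.measurableSet

lemma nonempty_plan (M : Model n Uc S) : Nonempty (Plan M) := by
  obtain ⟨y₁, hy₁⟩ := M.Y_nonempty
  obtain ⟨u₁, -⟩ := M.U_nonempty y₁ hy₁
  obtain ⟨g, hg, hgF⟩ := exists_measurable_selection (fun y => {u | y ∈ M.Y → u ∈ M.U y})
    (fun y => by
      by_cases hy : y ∈ M.Y
      · obtain ⟨u, hu⟩ := M.U_nonempty y hy
        exact ⟨u, fun _ => hu⟩
      · exact ⟨u₁, fun h => absurd h hy⟩)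
    (fun y => by
      by_cases hy : y ∈ M.Y
      · simpa [hy] using (M.U_compact y hy).isClosed
      · simp [hy])
    (fun D hD => by
      rcases D.eq_empty_or_nonempty with rfl | ⟨d, hd⟩
      · simp
      have hK : IsCompact ({p : (Fin n → ℝ) × Uc | p.1 ∈ M.Y ∧ p.2 ∈ M.U p.1} ∩ univ ×ˢ D) :=
        (M.Y_compact.prod isCompact_univ).of_isClosed_subset
          (M.graph_closed.inter (isClosed_univ.prod hD)) fun p hp => ⟨hp.1.1, trivial⟩
      convert (hK.image continuous_fst).isClosed.measurableSet.union
        M.measurableSet_Y.compl using 1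
      ext y
      simp only [mem_ofPred_eq, mem_union, mem_image, mem_compl_iff]
      by_cases hy : y ∈ M.Y
      · simp only [hy, not_true, or_false]
        constructor
        · rintro ⟨u, hu, huD⟩
          exact ⟨(y, u), ⟨⟨hy, hu trivial⟩, trivial, huD⟩, rfl⟩
        · rintro ⟨⟨_, u⟩, ⟨⟨_, hu⟩, _, huD⟩, rfl⟩
          exact ⟨u, fun _ => hu, huD⟩
      · simp only [hy, not_false_iff, or_true, iff_true]
        exact ⟨d, fun h => h.elim, hd⟩)
  exact ⟨⟨fun _ => g, fun _ => hg, fun _ y hy => hgF y hy⟩⟩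

/-- The plan followed from time `1` on. -/
def Plan.shift {M : Model n Uc S} (π : Plan M) : Plan M where
  π t := π.π (t + 1)
  measurable t := π.measurable (t + 1)
  feasible t := π.feasible (t + 1)

open Classical in
/-- The state reached in one step under the feedback `σ`, frozen outside of `Y`. -/
def stepFun (M : Model n Uc S) (σ : (Fin n → ℝ) → Uc) (p : (Fin n → ℝ) × S) : Fin n → ℝ :=
  if p.1 ∈ M.Y then M.f p.1 (σ p.1) p.2 else p.1

lemma measurable_stepFun (M : Model n Uc S) {σ : (Fin n → ℝ) → Uc} (hσ : Measurable σ) :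
    Measurable (stepFun M σ) := by
  classical
  have hu : Measurable (Function.uncurry fun (p : M.Y × Uc) (s : S) => M.f p.1 p.2 s) := by
    refine measurable_uncurry_of_continuous_of_measurable (fun s => ?_)
      fun p => M.f_meas _ p.1.2 _
    exact (M.f_cont s).comp_continuous (f := fun p : M.Y × Uc => ((p.1 : Fin n → ℝ), p.2))
      (by fun_prop) fun p => ⟨p.1.2, trivial⟩
  have hs : MeasurableSet {p : (Fin n → ℝ) × S | p.1 ∈ M.Y} := measurable_fst M.measurableSet_Y
  refine measurable_of_restrict_of_restrict_compl hs ?_ ?_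
  · have h : Measurable fun q : {p : (Fin n → ℝ) × S | p.1 ∈ M.Y} =>
        ((((⟨q.1.1, q.2⟩ : M.Y), σ q.1.1), q.1.2) : (M.Y × Uc) × S) :=
      ((measurable_subtype_coe.fst.subtype_mk).prodMk
        (hσ.comp measurable_subtype_coe.fst)).prodMk measurable_subtype_coe.snd
    convert hu.comp h using 1
    ext1 q
    have hq : q.1.1 ∈ M.Y := q.2
    simp [stepFun, hq, Function.uncurry]
  · convert (measurable_subtype_coe.fst :
      Measurable fun q : ({p : (Fin n → ℝ) × S | p.1 ∈ M.Y}ᶜ : Set _) => q.1.1) using 1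
    ext1 q
    have hq : q.1.1 ∉ M.Y := q.2
    simp [stepFun, hq]

/-- The one step transition kernel under the feedback `σ`. -/
def stepKernel (M : Model n Uc S) (σ : (Fin n → ℝ) → Uc) :
    ProbabilityTheory.Kernel (Fin n → ℝ) (Fin n → ℝ) :=
  (ProbabilityTheory.Kernel.id.prod (ProbabilityTheory.Kernel.const _ M.ν)).map (stepFun M σ)

lemma isMarkovKernel_stepKernel (M : Model n Uc S) {σ : (Fin n → ℝ) → Uc}
    (hσ : Measurable σ) : ProbabilityTheory.IsMarkovKernel (stepKernel M σ) := by
  have := M.ν_prob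
  exact ProbabilityTheory.Kernel.IsMarkovKernel.map _ (measurable_stepFun M hσ)

lemma stepKernel_apply (M : Model n Uc S) {σ : (Fin n → ℝ) → Uc} (hσ : Measurable σ)
    {y : Fin n → ℝ} (hy : y ∈ M.Y) :
    stepKernel M σ y = M.ν.map fun s => M.f y (σ y) s := by
  have := M.ν_prob
  rw [stepKernel, ProbabilityTheory.Kernel.map_apply _ (measurable_stepFun M hσ),
    ProbabilityTheory.Kernel.prod_apply, ProbabilityTheory.Kernel.id_apply,
    ProbabilityTheory.Kernel.const_apply, Measure.dirac_prod,
    Measure.map_map (measurable_stepFun M hσ) measurable_prodMk_left]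
  congr 1
  ext1 s
  simp [stepFun, hy]

lemma integral_stepKernel (M : Model n Uc S) {σ : (Fin n → ℝ) → Uc} (hσ : Measurable σ)
    {y : Fin n → ℝ} (hy : y ∈ M.Y) {φ : (Fin n → ℝ) → ℝ} (hφ : Measurable φ) :
    ∫ z, φ z ∂stepKernel M σ y = Ef M φ y (σ y) := by
  rw [stepKernel_apply M hσ hy, integral_map (M.f_meas y hy _).aemeasurable
    hφ.aestronglyMeasurable, Ef]

lemma ae_stepKernel_mem (M : Model n Uc S) {σ : (Fin n → ℝ) → Uc} (hσ : Measurable σ)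
    (hσU : ∀ y ∈ M.Y, σ y ∈ M.U y) {y : Fin n → ℝ} (hy : y ∈ M.Y) :
    ∀ᵐ z ∂stepKernel M σ y, z ∈ M.Y := by
  rw [stepKernel_apply M hσ hy]
  refine (ae_map_iff (p := (· ∈ M.Y)) (M.f_meas y hy _).aemeasurable M.measurableSet_Y).2 ?_
  exact Eventually.of_forall fun s => M.f_inv y hy _ (hσU y hy) s

/-- The law of the state at time `t` as a kernel in the initial state. -/
def stateKernel (M : Model n Uc S) : ℕ → Plan M →
    ProbabilityTheory.Kernel (Fin n → ℝ) (Fin n → ℝ)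
  | 0, _ => ProbabilityTheory.Kernel.id
  | t + 1, π => (stateKernel M t π.shift).comp (stepKernel M (π.π 0))

lemma stateLaw_eq_stateKernel (M : Model n Uc S) (t : ℕ) (π : Plan M) {y : Fin n → ℝ}
    (hy : y ∈ M.Y) : stateLaw M t π.π y = stateKernel M t π y := by
  induction t generalizing π y with
  | zero => exact (ProbabilityTheory.Kernel.id_apply y).symm
  | succ t ih =>
    rw [stateKernel, ProbabilityTheory.Kernel.comp_apply]
    change (M.ν.map fun s => M.f y (π.π 0 y) s).bind
      (fun y' => stateLaw M t π.shift.π y') = _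
    rw [← stepKernel_apply M (π.measurable 0) hy]
    refine Measure.bind_congr_right ?_
    filter_upwards [ae_stepKernel_mem M (π.measurable 0) (π.feasible 0) hy] with z hz
    exact ih π.shift hz

lemma stateKernel_succ (M : Model n Uc S) (t : ℕ) (π : Plan M) :
    stateKernel M (t + 1) π = (stepKernel M (π.π t)).comp (stateKernel M t π) := by
  induction t generalizing π with
  | zero => simp [stateKernel]
  | succ t ih =>
    rw [stateKernel, ih, ProbabilityTheory.Kernel.comp_assoc]
    rfl

lemma isMarkovKernel_stateKernel (M : Model n Uc S) (t : ℕ) (π : Plan M) :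
    ProbabilityTheory.IsMarkovKernel (stateKernel M t π) := by
  induction t with
  | zero => rw [stateKernel]; infer_instance
  | succ t ih =>
    have := isMarkovKernel_stepKernel M (π.measurable t)
    rw [stateKernel_succ]
    infer_instance

lemma ae_stateKernel_mem (M : Model n Uc S) (t : ℕ) (π : Plan M) {y : Fin n → ℝ}
    (hy : y ∈ M.Y) : ∀ᵐ z ∂stateKernel M t π y, z ∈ M.Y := by
  induction t with
  | zero =>
    rw [stateKernel, ProbabilityTheory.Kernel.id_apply]
    exact (ae_dirac_iff (p := (· ∈ M.Y)) M.measurableSet_Y).2 hy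
  | succ t ih =>
    rw [stateKernel_succ]
    refine (ProbabilityTheory.Kernel.ae_comp_iff (p := (· ∈ M.Y)) M.measurableSet_Y).2 ?_
    filter_upwards [ih] with z hz
    exact ae_stepKernel_mem M (π.measurable t) (π.feasible t) hz

/-- The running cost along a plan is integrable. -/
lemma integrable_cost (M : Model n Uc S) {k : (Fin n → ℝ) → Uc → ℝ}
    (hk : ContinuousOn (fun p : (Fin n → ℝ) × Uc => k p.1 p.2) (M.Y ×ˢ (univ : Set Uc)))
    {C : ℝ} (hkC : ∀ y ∈ M.Y, ∀ u : Uc, |k y u| ≤ C) (t : ℕ) (π : Plan M) {y : Fin n → ℝ}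
    (hy : y ∈ M.Y) :
    Integrable (fun z => k z (π.π t z)) (stateKernel M t π y) ∧
      expSA M t π.π y k = ∫ z, k z (π.π t z) ∂stateKernel M t π y := by
  have := isMarkovKernel_stateKernel M t π
  have hY := ae_stateKernel_mem M t π hy
  have hm : Measurable fun z => (z, π.π t z) := measurable_id.prodMk (π.measurable t)
  have hmY : MeasurableSet (M.Y ×ˢ (univ : Set Uc)) := M.measurableSet_Y.prod .univ
  have hsm : AEStronglyMeasurable (fun p : (Fin n → ℝ) × Uc => k p.1 p.2)
      ((stateKernel M t π y).map fun z => (z, π.π t z)) := by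
    rw [← Measure.restrict_eq_self_of_ae_mem (s := M.Y ×ˢ (univ : Set Uc))
      (μ := (stateKernel M t π y).map fun z => (z, π.π t z))]
    · exact hk.aestronglyMeasurable hmY
    · refine (ae_map_iff (p := (· ∈ M.Y ×ˢ (univ : Set Uc))) hm.aemeasurable hmY).2 ?_
      filter_upwards [hY] with z hz using ⟨hz, trivial⟩
  constructor
  · refine Integrable.of_bound (hsm.comp_measurable hm) C ?_
    filter_upwards [hY] with z hz using hkC z hz _
  · rw [expSA, saLaw, stateLaw_eq_stateKernel M t π hy, integral_map hm.aemeasurable hsm]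

lemma abs_expSA_le (M : Model n Uc S) {k : (Fin n → ℝ) → Uc → ℝ}
    (hk : ContinuousOn (fun p : (Fin n → ℝ) × Uc => k p.1 p.2) (M.Y ×ˢ (univ : Set Uc)))
    {C : ℝ} (hkC : ∀ y ∈ M.Y, ∀ u : Uc, |k y u| ≤ C) (t : ℕ) (π : Plan M) {y : Fin n → ℝ}
    (hy : y ∈ M.Y) : |expSA M t π.π y k| ≤ C := by
  have := isMarkovKernel_stateKernel M t π
  rw [(integrable_cost M hk hkC t π hy).2]
  have h := norm_integral_le_of_norm_le_const (μ := stateKernel M t π y)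
    (f := fun z => k z (π.π t z)) (C := C) (by
      filter_upwards [ae_stateKernel_mem M t π hy] with z hz using hkC z hz _)
  simpa using h

lemma BddBorel.integrable {φ : (Fin n → ℝ) → ℝ} (hφ : BddBorel φ)
    (μ : Measure (Fin n → ℝ)) [IsFiniteMeasure μ] : Integrable φ μ := by
  obtain ⟨hm, D, hD⟩ := hφ
  exact Integrable.of_bound hm.aestronglyMeasurable D (Eventually.of_forall hD)

/-- Markov property: the expectation at time `t + 1` through the one step expectation. -/
lemma integral_stateKernel_succ (M : Model n Uc S) (t : ℕ) (π : Plan M) {y : Fin n → ℝ}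
    (hy : y ∈ M.Y) {φ : (Fin n → ℝ) → ℝ} (hφ : BddBorel φ) :
    Integrable (fun z => Ef M φ z (π.π t z)) (stateKernel M t π y) ∧
      ∫ z, φ z ∂stateKernel M (t + 1) π y =
        ∫ z, Ef M φ z (π.π t z) ∂stateKernel M t π y := by
  have := isMarkovKernel_stateKernel M t π
  have := isMarkovKernel_stepKernel M (π.measurable t)
  have hae : (fun z => ∫ x, φ x ∂stepKernel M (π.π t) z)
      =ᵐ[stateKernel M t π y] fun z => Ef M φ z (π.π t z) := by
    filter_upwards [ae_stateKernel_mem M t π hy] with z hz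
    exact integral_stepKernel M (π.measurable t) hz hφ.1
  have hint := hφ.integrable (((stepKernel M (π.π t)).comp (stateKernel M t π)) y)
  exact ⟨hint.integral_comp.congr hae, by
    rw [stateKernel_succ, ProbabilityTheory.Kernel.integral_comp hint, integral_congr_ae hae]⟩

/-- A dual feasible point bounds the running cost from below up to a telescoping term. -/
lemma DualFeas.le_expSA {M : Model n Uc S} {k : (Fin n → ℝ) → Uc → ℝ}
    (hk : ContinuousOn (fun p : (Fin n → ℝ) × Uc => k p.1 p.2) (M.Y ×ˢ (univ : Set Uc)))
    {C : ℝ} (hkC : ∀ y ∈ M.Y, ∀ u : Uc, |k y u| ≤ C) {y : Fin n → ℝ} (hy : y ∈ M.Y)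
    {ψ η : (Fin n → ℝ) → ℝ} {μ : ℝ} (hψ : BddBorel ψ) (hη : BddBorel η)
    (h : DualFeas M k y ψ η μ) (π : Plan M) (t : ℕ) :
    μ + (∫ z, η z ∂stateKernel M t π y - ∫ z, η z ∂stateKernel M (t + 1) π y) ≤
      expSA M t π.π y k := by
  have hG : ∀ t, ∀ᵐ z ∂stateKernel M t π y, (z, π.π t z) ∈ graphG M := fun t => by
    filter_upwards [ae_stateKernel_mem M t π hy] with z hz using ⟨hz, π.feasible t z hz⟩
  have hmono : ∀ t, ψ y ≤ ∫ z, ψ z ∂stateKernel M t π y := by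
    intro t
    induction t with
    | zero => simp [stateKernel, ProbabilityTheory.Kernel.id_apply]
    | succ t ih =>
      have := isMarkovKernel_stateKernel M t π
      refine ih.trans ?_
      obtain ⟨hi, he⟩ := integral_stateKernel_succ M t π hy hψ
      rw [he]
      refine integral_mono_ae (hψ.integrable _) hi ?_
      filter_upwards [hG t] with z hz
      exact sub_nonneg.1 (h.2 _ hz)
  have := isMarkovKernel_stateKernel M t π
  obtain ⟨hki, hke⟩ := integrable_cost M hk hkC t π hy
  obtain ⟨hηi, hηe⟩ := integral_stateKernel_succ M t π hy hη
  have h1 : Integrable (fun z => k z (π.π t z) - ψ z) (stateKernel M t π y) :=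
    hki.sub (hψ.integrable _)
  have h2 : Integrable (fun z => Ef M η z (π.π t z) - η z) (stateKernel M t π y) :=
    hηi.sub (hη.integrable _)
  have h3 : ∫ _, (μ - ψ y) ∂stateKernel M t π y ≤
      ∫ z, ((k z (π.π t z) - ψ z) + (Ef M η z (π.π t z) - η z)) ∂stateKernel M t π y := by
    refine integral_mono_ae (integrable_const _) (h1.add h2) ?_
    filter_upwards [hG t] with z hz
    have := h.1 _ hz
    dsimp only at this ⊢
    linarith
  rw [integral_add h1 h2, integral_sub hki (hψ.integrable _),
    integral_sub hηi (hη.integrable _), ← hηe, ← hke] at h3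
  simp only [integral_const, probReal_univ, one_smul] at h3
  linarith [hmono t]

lemma BddBorel.exists_abs_integral_le {φ : (Fin n → ℝ) → ℝ} (hφ : BddBorel φ)
    (M : Model n Uc S) (y : Fin n → ℝ) :
    ∃ D : ℝ, ∀ (π : Plan M) (t : ℕ), |∫ z, φ z ∂stateKernel M t π y| ≤ D := by
  obtain ⟨-, D, hD⟩ := hφ
  refine ⟨D, fun π t => ?_⟩
  have := isMarkovKernel_stateKernel M t π
  simpa using norm_integral_le_of_norm_le_const (μ := stateKernel M t π y)
    (f := φ) (C := D) (Eventually.of_forall hD)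

/-- Cesàro means of a sequence bounded below up to a telescoping term. -/
lemma le_average_of_telescope {a c : ℕ → ℝ} {μ D : ℝ} (ha : ∀ t, |a t| ≤ D)
    (h : ∀ t, μ + (a t - a (t + 1)) ≤ c t) {T : ℕ} (hT : 0 < T) :
    μ - 2 * D / T ≤ 1 / (T : ℝ) * ∑ t ∈ Finset.range T, c t := by
  have h1 := Finset.sum_le_sum fun t (_ : t ∈ Finset.range T) => h t
  rw [Finset.sum_add_distrib, Finset.sum_range_sub'] at h1
  simp only [Finset.sum_const, Finset.card_range, nsmul_eq_mul] at h1
  have hT' : (0 : ℝ) < T := Nat.cast_pos.2 hT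
  have h0 := (abs_le.1 (ha 0)).1
  have hTb := (abs_le.1 (ha T)).2
  calc μ - 2 * D / T = 1 / (T : ℝ) * (T * μ - 2 * D) := by field_simp
    _ ≤ _ := by gcongr; linarith

lemma summable_geometric_mul_of_bounded {a : ℕ → ℝ} {D ε : ℝ} (ha : ∀ t, |a t| ≤ D)
    (hε : ε ∈ Ioo (0 : ℝ) 1) : Summable fun t => (1 - ε) ^ t * a t := by
  have h0 : 0 ≤ 1 - ε := by linarith [hε.2]
  refine Summable.of_norm_bounded
    ((summable_geometric_of_lt_one h0 (by linarith [hε.1])).mul_right D) fun t => ?_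
  rw [norm_mul, norm_pow, Real.norm_eq_abs, Real.norm_eq_abs, abs_of_nonneg h0]
  gcongr
  exact ha t

lemma abs_discounted_le {a : ℕ → ℝ} {D ε : ℝ} (ha : ∀ t, |a t| ≤ D)
    (hε : ε ∈ Ioo (0 : ℝ) 1) : |ε * ∑' t, (1 - ε) ^ t * a t| ≤ D := by
  have h0 : 0 ≤ 1 - ε := by linarith [hε.2]
  have hg := summable_geometric_of_lt_one h0 (by linarith [hε.1])
  have hsum := tsum_geometric_of_lt_one h0 (by linarith [hε.1] : 1 - ε < 1)
  have hb : ‖∑' t, (1 - ε) ^ t * a t‖ ≤ ε⁻¹ * D := by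
    refine tsum_of_norm_bounded (f := fun t => (1 - ε) ^ t * a t)
      (g := fun t => (1 - ε) ^ t * D) ?_ fun t => ?_
    · have := hg.hasSum.mul_right D
      rwa [hsum, sub_sub_cancel] at this
    · rw [norm_mul, norm_pow, Real.norm_eq_abs, Real.norm_eq_abs, abs_of_nonneg h0]
      gcongr
      exact ha t
  rw [abs_mul, abs_of_pos hε.1]
  calc ε * |∑' t, (1 - ε) ^ t * a t| ≤ ε * (ε⁻¹ * D) := by
        have := hε.1
        gcongr
        exact hb
    _ = D := mul_inv_cancel_left₀ hε.1.ne' D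

/-- Abel means of a sequence bounded below up to a telescoping term. -/
lemma le_discounted_of_telescope {a c : ℕ → ℝ} {μ C D ε : ℝ} (ha : ∀ t, |a t| ≤ D)
    (hc : ∀ t, |c t| ≤ C) (h : ∀ t, μ + (a t - a (t + 1)) ≤ c t) (hε : ε ∈ Ioo (0 : ℝ) 1) :
    μ - 2 * D * ε ≤ ε * ∑' t, (1 - ε) ^ t * c t := by
  have h0 : 0 ≤ 1 - ε := by linarith [hε.2]
  have ha' : ∀ t, |a (t + 1)| ≤ D := fun t => ha (t + 1)
  have hs := summable_geometric_mul_of_bounded ha hε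
  have hs' := summable_geometric_mul_of_bounded ha' hε
  have hg := summable_geometric_of_lt_one h0 (by linarith [hε.1])
  have hsum := tsum_geometric_of_lt_one h0 (by linarith [hε.1] : 1 - ε < 1)
  rw [sub_sub_cancel] at hsum
  have hshift : ∑' t, (1 - ε) ^ t * a t = a 0 + (1 - ε) * ∑' t, (1 - ε) ^ t * a (t + 1) := by
    rw [hs.tsum_eq_zero_add, ← tsum_mul_left]
    simp [pow_succ', mul_assoc]
  have hle : ∑' t, ((1 - ε) ^ t * μ + ((1 - ε) ^ t * a t - (1 - ε) ^ t * a (t + 1))) ≤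
      ∑' t, (1 - ε) ^ t * c t := by
    refine ((hg.mul_right μ).add (hs.sub hs')).tsum_le_tsum (fun t => ?_)
      (summable_geometric_mul_of_bounded hc hε)
    rw [← mul_sub, ← mul_add]
    exact mul_le_mul_of_nonneg_left (h t) (pow_nonneg h0 t)
  rw [(hg.mul_right μ).tsum_add (hs.sub hs'), hs.tsum_sub hs', tsum_mul_right, hsum,
    hshift] at hle
  have hb := (abs_le.1 (abs_discounted_le ha' hε)).2
  have h00 := (abs_le.1 (ha 0)).1
  have hle' := mul_le_mul_of_nonneg_left hle hε.1.le
  refine le_trans ?_ hle'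
  rw [mul_add, mul_inv_cancel_left₀ hε.1.ne']
  nlinarith [hε.1]

lemma le_liminf_of_tendsto_le {ι : Type*} {l : Filter ι} [l.NeBot] {g v : ι → ℝ} {μ C : ℝ}
    (hg : Tendsto g l (𝓝 μ)) (hgv : ∀ᶠ i in l, g i ≤ v i) (hv : ∀ᶠ i in l, v i ≤ C) :
    μ ≤ liminf v l := by
  rw [← hg.liminf_eq]
  refine liminf_le_liminf hgv hg.isBoundedUnder_ge ?_
  exact IsBoundedUnder.isCoboundedUnder_ge ⟨C, hv⟩

/-- lower bounds for the Cesàro and Abel limits,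
`d̂*(y₀) ≤ liminf_{T→∞} v_T(y₀)` and `d̂*(y₀) ≤ liminf_{ε→0} h_ε(y₀)`. -/
theorem statement7 (M : Model n Uc S) (k : (Fin n → ℝ) → Uc → ℝ)
    (hk : ContinuousOn (fun p : (Fin n → ℝ) × Uc => k p.1 p.2) (M.Y ×ˢ (univ : Set Uc)))
    (C : ℝ) (hkC : ∀ y ∈ M.Y, ∀ u : Uc, |k y u| ≤ C) :
    ∀ y0 ∈ M.Y,
      dHatStar M k y0 ≤ Filter.liminf (fun T : ℕ => vT M k T y0) atTop ∧
      dHatStar M k y0 ≤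
        Filter.liminf (fun ε : ℝ => hEps M k ε y0) (𝓝[Set.Ioo (0 : ℝ) 1] 0) := by
  intro y0 hy0
  obtain ⟨π₀⟩ := nonempty_plan M
  have : Nonempty (Plan M) := ⟨π₀⟩
  have hexp := fun (π : Plan M) t => abs_expSA_le M hk hkC t π hy0
  have hC : 0 ≤ C := (abs_nonneg _).trans (hexp π₀ 0)
  have hCT : ∀ (π : Plan M) (T : ℕ), 0 < T → |costT M k T π.π y0| ≤ C := fun π T hT => by
    have hT' : (0 : ℝ) < T := Nat.cast_pos.2 hT
    rw [costT, abs_mul, abs_of_pos (by positivity)]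
    calc 1 / (T : ℝ) * |∑ t ∈ Finset.range T, expSA M t π.π y0 k|
        ≤ 1 / (T : ℝ) * ∑ t ∈ Finset.range T, C := by
          gcongr
          exact (Finset.abs_sum_le_sum_abs _ _).trans (Finset.sum_le_sum fun t _ => hexp π t)
      _ = C := by simp [hT'.ne']
  have hCε : ∀ (π : Plan M), ∀ ε ∈ Ioo (0 : ℝ) 1, |costDisc M k ε π.π y0| ≤ C :=
    fun π ε hε => abs_discounted_le (hexp π) hε
  have hvC : ∀ᶠ T : ℕ in atTop, vT M k T y0 ≤ C := by
    filter_upwards [eventually_gt_atTop 0] with T hT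
    exact (ciInf_le ⟨-C, by rintro _ ⟨π, rfl⟩; exact (abs_le.1 (hCT π T hT)).1⟩ π₀).trans
      (abs_le.1 (hCT π₀ T hT)).2
  have hhC : ∀ᶠ ε : ℝ in 𝓝[Ioo (0 : ℝ) 1] 0, hEps M k ε y0 ≤ C := by
    filter_upwards [self_mem_nhdsWithin] with ε hε
    exact (ciInf_le ⟨-C, by rintro _ ⟨π, rfl⟩; exact (abs_le.1 (hCε π ε hε)).1⟩ π₀).trans
      (abs_le.1 (hCε π₀ ε hε)).2
  have hne : {μ : ℝ | ∃ ψ η : (Fin n → ℝ) → ℝ, BddBorel ψ ∧ BddBorel η ∧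
      DualFeas M k y0 ψ η μ}.Nonempty := by
    have hz : BddBorel (fun _ : Fin n → ℝ => (0 : ℝ)) := ⟨measurable_const, 0, by simp⟩
    refine ⟨-C, fun _ => 0, fun _ => 0, hz, hz, fun p hp => ?_, fun p _ => by simp [Ef]⟩
    simp only [Ef, integral_zero, sub_zero, add_zero]
    linarith [(abs_le.1 (hkC p.1 hp.1 p.2)).1]
  have hbot : (𝓝[Ioo (0 : ℝ) 1] (0 : ℝ)).NeBot := by
    rw [nhdsWithin_Ioo_eq_nhdsGT one_pos]
    infer_instance
  refine ⟨csSup_le hne ?_, csSup_le hne ?_⟩ <;> rintro μ ⟨ψ, η, hψ, hη, hd⟩ <;>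
    obtain ⟨D, hD⟩ := hη.exists_abs_integral_le M y0
  · have hlim : Tendsto (fun T : ℕ => μ - 2 * D / (T : ℝ)) atTop (𝓝 μ) := by
      simpa using tendsto_const_nhds.sub (tendsto_const_div_atTop_nhds_zero_nat (2 * D))
    refine le_liminf_of_tendsto_le hlim ?_ hvC
    filter_upwards [eventually_gt_atTop 0] with T hT
    exact le_ciInf fun π =>
      le_average_of_telescope (hD π) (hd.le_expSA hk hkC hy0 hψ hη π) hT
  · have hlim : Tendsto (fun ε : ℝ => μ - 2 * D * ε) (𝓝[Ioo (0 : ℝ) 1] 0) (𝓝 μ) := by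
      have : Continuous fun ε : ℝ => μ - 2 * D * ε := by fun_prop
      simpa using (this.tendsto 0).mono_left nhdsWithin_le_nhds
    refine le_liminf_of_tendsto_le hlim ?_ hhC
    filter_upwards [self_mem_nhdsWithin] with ε hε
    exact le_ciInf fun π => le_discounted_of_telescope (hD π) (hexp π)
      (hd.le_expSA hk hkC hy0 hψ hη π) hε

end StochLP
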